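/- Under Assumption 1, the function W : R₀ → ℝ defined by W(x₀) = sup_π Σ_{i=0}^{∞} ln(g(φ_{x₀}^π(i)) + 1) is real-valued and continuous on the maximal robust region of uniform attraction R₀. -/

import Mathlib

open Metric Set Filter MeasureTheory

noncomputable section

abbrev St (n : ℕ) := EuclideanSpace ℝ (Fin n)

/-- Trajectory of the perturbed discrete-time system. -/
def traj {n m : ℕ} (f : St n → St m → St n) (x₀ : St n) (π : ℕ → St m) : ℕ → St n
  | 0 => x₀
  | k + 1 => f (traj f x₀ π k) (π k)

/-- A perturbation input policy takes values in `D`. -/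
def IsPolicy {m : ℕ} (D : Set (St m)) (π : ℕ → St m) : Prop := ∀ k, π k ∈ D

/-- Maximal robust region of attraction. -/
def RoA {n m : ℕ} (f : St n → St m → St n) (D : Set (St m)) (X : Set (St n)) : Set (St n) :=
  {x₀ | ∀ π, IsPolicy D π →
    (∀ k, traj f x₀ π k ∈ X) ∧ Tendsto (fun k => traj f x₀ π k) atTop (nhds 0)}

/-- `f` is a polynomial map in `(x, d)`. -/
def IsPolyMap2 {n m : ℕ} (f : St n → St m → St n) : Prop :=
  ∃ p : Fin n → MvPolynomial (Fin n ⊕ Fin m) ℝ,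
    ∀ x d i, f x d i = MvPolynomial.eval (Sum.elim x d) (p i)

/-- A real-valued polynomial function on the state space. -/
def IsPolyFun {n : ℕ} (g : St n → ℝ) : Prop :=
  ∃ p : MvPolynomial (Fin n) ℝ, ∀ x, g x = MvPolynomial.eval x p

/-- Assumption 1: uniform local exponential stability. -/
def Assumption1 {n m : ℕ} (f : St n → St m → St n) (D : Set (St m)) (X : Set (St n)) : Prop :=
  ∃ M r lam : ℝ, 0 < M ∧ 0 < r ∧ 0 < lam ∧ lam < 1 ∧ closedBall (0 : St n) r ⊆ X ∧
    ∀ x₀ ∈ closedBall (0 : St n) r, ∀ π, IsPolicy D π →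
      ∀ k, ‖traj f x₀ π k‖ ≤ lam ^ k * M * ‖x₀‖

/-- Maximal robust region of uniform attraction (with ball radius `ε`). -/
def R0 {n m : ℕ} (f : St n → St m → St n) (D : Set (St m)) (X : Set (St n)) (ε : ℝ) :
    Set (St n) :=
  {x₀ | (∃ δ > 0, ∀ π, IsPolicy D π → ∀ k, δ < infDist (traj f x₀ π k) Xᶜ) ∧
        (∃ K : ℕ, ∀ π, IsPolicy D π →
            ∃ k, 0 < k ∧ k ≤ K ∧ traj f x₀ π k ∈ closedBall (0 : St n) ε)}

/-- Extended-real logarithm with the convention `ln 0 = -∞`. -/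
def elog (t : ℝ) : EReal := if t = 0 then ⊥ else (Real.log t : EReal)

/-- The value function `V`. -/
def Vval {n m nX : ℕ} (f : St n → St m → St n) (D : Set (St m))
    (hX : Fin nX → St n → ℝ) (g : St n → ℝ) (x : St n) : EReal :=
  ⨆ π ∈ {π : ℕ → St m | IsPolicy D π}, ⨆ k : ℕ,
    ((∑ i ∈ Finset.range k, Real.log (g (traj f x π i) + 1) : ℝ) : EReal)
      - ⨅ j : Fin nX, elog (max (1 - hX j (traj f x π k)) 0)

/-- The Kruzhkov transformed value function `v = 1 - e^{-V}` (with `e^{-∞} = 0`). -/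
def vval {n m nX : ℕ} (f : St n → St m → St n) (D : Set (St m))
    (hX : Fin nX → St n → ℝ) (g : St n → ℝ) (x : St n) : ℝ :=
  if Vval f D hX g x = ⊤ then 1 else 1 - Real.exp (-(Vval f D hX g x).toReal)

/-- `w` is a (bounded continuous) solution of the Bellman equation. -/
def IsBellmanSolution {n m nX : ℕ} (f : St n → St m → St n) (D : Set (St m))
    (hX : Fin nX → St n → ℝ) (g : St n → ℝ) (w : St n → ℝ) : Prop :=
  (∀ x, min (sInf {y : ℝ | ∃ d ∈ D, y = w x - w (f x d) - g x * (1 - w x)})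
            (w x - 1 + ⨅ j : Fin nX, max (1 - hX j x) 0) = 0) ∧ w 0 = 0

open Topology in
/-- If the terms `F i` are jointly continuous and nonnegative, and their tails are dominated by a
summable sequence uniformly near `x₀` and over a compact parameter set, then the supremum over the
parameters of the sum of the series is finite and continuous at `x₀`. -/
theorem iSup_tsum_ne_top_and_continuousAt {E Y : Type*} [TopologicalSpace E] [TopologicalSpace Y]
    {F : ℕ → E → Y → ℝ} {P : Set Y} {U : Set E} {x₀ : E} {b : ℕ → ℝ} (N : ℕ)
    (hP : IsCompact P) (hU : IsCompact U) (hUx : U ∈ 𝓝 x₀)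
    (hF : ∀ i, Continuous (F i).uncurry) (hF0 : ∀ i x y, 0 ≤ F i x y) (hb : Summable b)
    (hFb : ∀ i, ∀ x ∈ U, ∀ y ∈ P, F (i + N) x y ≤ b i) :
    (⨆ y ∈ P, ∑' i, ENNReal.ofReal (F i x₀ y)) ≠ ⊤ ∧
      ContinuousAt (fun x => (⨆ y ∈ P, ∑' i, ENNReal.ofReal (F i x y)).toReal) x₀ := by
  have hbd : ∀ i, ∃ B, ∀ p ∈ U ×ˢ P, ‖(F i).uncurry p‖ ≤ B := fun i =>
    (hU.prod hP).exists_bound_of_continuousOn (hF i).continuousOn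
  choose B hB using hbd
  have hx₀ : x₀ ∈ U := mem_of_mem_nhds hUx
  obtain ⟨c, hc, hFc⟩ : ∃ c : ℕ → ℝ, Summable c ∧
      ∀ i, ∀ p ∈ U ×ˢ P, ‖(F i).uncurry p‖ ≤ c i := by
    refine ⟨fun i => if i < N then B i else b (i - N), ?_, fun i p hp => ?_⟩
    · rw [← summable_nat_add_iff N]
      simpa using hb
    · by_cases hi : i < N
      · simpa [hi] using hB i p hp
      · have h := hFb (i - N) p.1 hp.1 p.2 hp.2
        rw [Nat.sub_add_cancel (not_lt.1 hi)] at h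
        simpa [hi, Function.uncurry, abs_of_nonneg (hF0 i p.1 p.2)] using h
  have hsum : ∀ x ∈ U, ∀ y ∈ P, Summable fun i => F i x y := fun x hx y hy =>
    hc.of_norm_bounded fun i => hFc i (x, y) ⟨hx, hy⟩
  set S : E → Y → ℝ := fun x y => ∑' i, F i x y with hS
  have hof : ∀ x ∈ U, ∀ y ∈ P, ∑' i, ENNReal.ofReal (F i x y) = ENNReal.ofReal (S x y) :=
    fun x hx y hy => (ENNReal.ofReal_tsum_of_nonneg (fun i => hF0 i x y) (hsum x hx y hy)).symm
  have hSc : ContinuousOn S.uncurry (U ×ˢ P) :=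
    continuousOn_tsum (f := fun i => (F i).uncurry) (fun i => (hF i).continuousOn) hc hFc
  have hfin : (⨆ y ∈ P, ∑' i, ENNReal.ofReal (F i x₀ y)) ≠ ⊤ := by
    refine ne_top_of_le_ne_top (ENNReal.ofReal_ne_top (r := ∑' i, c i)) (iSup₂_le fun y hy => ?_)
    rw [hof x₀ hx₀ y hy]
    exact ENNReal.ofReal_le_ofReal ((hsum x₀ hx₀ y hy).tsum_le_tsum
      (fun i => (le_abs_self _).trans (hFc i (x₀, y) ⟨hx₀, hy⟩)) hc)
  refine ⟨hfin, (ENNReal.tendsto_toReal hfin).comp ((ENNReal.tendsto_nhds hfin).2 fun ε hε => ?_)⟩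
  obtain ⟨e, he0, heε⟩ : ∃ e : ℝ, 0 < e ∧ ENNReal.ofReal e ≤ ε := by
    obtain ⟨e, he0, he⟩ := ENNReal.lt_iff_exists_nnreal_btwn.1 hε
    exact ⟨e, by exact_mod_cast he0, by simpa using he.le⟩
  obtain ⟨v, hv, hvS⟩ := hP.mem_uniformity_of_prod hSc hx₀ (Metric.dist_mem_uniformity he0)
  rw [nhdsWithin_eq_nhds.2 hUx] at hv
  have key : ∀ x ∈ U, ∀ z ∈ U, (∀ y ∈ P, S x y ≤ S z y + e) →
      (⨆ y ∈ P, ∑' i, ENNReal.ofReal (F i x y)) ≤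
        (⨆ y ∈ P, ∑' i, ENNReal.ofReal (F i z y)) + ε := by
    intro x hx z hz h
    refine iSup₂_le fun y hy => ?_
    calc ∑' i, ENNReal.ofReal (F i x y) = ENNReal.ofReal (S x y) := hof x hx y hy
      _ ≤ ENNReal.ofReal (S z y) + ENNReal.ofReal e :=
        (ENNReal.ofReal_le_ofReal (h y hy)).trans ENNReal.ofReal_add_le
      _ ≤ _ := by
        rw [← hof z hz y hy]
        exact add_le_add (le_iSup₂ (f := fun y _ => ∑' i, ENNReal.ofReal (F i z y)) y hy) heε
  filter_upwards [hv, hUx] with x hxv hxU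
  have hd : ∀ y ∈ P, |S x y - S x₀ y| < e := fun y hy => hvS x hxv y hy
  refine ⟨tsub_le_iff_right.2 (key x₀ hx₀ x hxU fun y hy => ?_),
    key x hxU x₀ hx₀ fun y hy => ?_⟩
  · linarith [(abs_lt.1 (hd y hy)).1]
  · linarith [(abs_lt.1 (hd y hy)).2]

theorem IsPolyMap2.continuous {n m : ℕ} {f : St n → St m → St n} (hf : IsPolyMap2 f) :
    Continuous f.uncurry := by
  obtain ⟨p, hp⟩ := hf
  refine (PiLp.homeomorph 2 (fun _ : Fin n => ℝ)).comp_continuous_iff.1 (continuous_pi fun i => ?_)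
  have h : Continuous fun q : St n × St m =>
      MvPolynomial.eval (Sum.elim (q.1 : Fin n → ℝ) q.2) (p i) := by
    refine (MvPolynomial.continuous_eval (p i)).comp (continuous_pi fun j => ?_)
    cases j <;> simp only [Sum.elim_inl, Sum.elim_inr] <;> fun_prop
  exact h.congr fun q => (hp q.1 q.2 i).symm

theorem IsPolyFun.contDiff {n : ℕ} {g : St n → ℝ} (hg : IsPolyFun g) {k : WithTop ℕ∞} :
    ContDiff ℝ k g := by
  obtain ⟨p, hp⟩ := hg
  have h := AnalyticOnNhd.eval_continuousLinearMap
    (EuclideanSpace.equiv (Fin n) ℝ).toContinuousLinearMap p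
  exact (funext hp : g = _) ▸ (AnalyticOnNhd.contDiff h)

theorem continuous_traj {n m : ℕ} {f : St n → St m → St n} (hf : Continuous f.uncurry) (k : ℕ) :
    Continuous (Function.uncurry fun x π => traj f x π k) := by
  induction k with
  | zero => exact continuous_fst
  | succ k ih => exact hf.comp (ih.prodMk ((continuous_apply k).comp continuous_snd))

theorem traj_add {n m : ℕ} (f : St n → St m → St n) (x : St n) (π : ℕ → St m) (k j : ℕ) :
    traj f x π (k + j) = traj f (traj f x π k) (fun i => π (k + i)) j := by
  induction j with
  | zero => rfl
  | succ j ih => rw [← add_assoc, traj, traj, ih]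

theorem isCompact_setOf_isPolicy {m : ℕ} {D : Set (St m)} (hD : IsCompact D) :
    IsCompact {π : ℕ → St m | IsPolicy D π} := by
  have h := isCompact_univ_pi fun _ : ℕ => hD
  convert h using 1
  ext π
  simp [IsPolicy]

open Topology in
/-- If every admissible trajectory from `x₀` reaches the ball of radius `ρ < r` within `K` steps,
then under uniform exponential stability on the ball of radius `r`, all trajectories starting near
`x₀` decay at a common geometric rate after time `K`. -/
theorem exists_nhds_norm_traj_le {n m : ℕ} {f : St n → St m → St n} (hf : Continuous f.uncurry)
    {D : Set (St m)} (hD : IsCompact D) {M r lam ρ : ℝ} (hM : 0 < M) (hlam0 : 0 < lam)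
    (hlam1 : lam < 1) (hρ : ρ < r)
    (hstab : ∀ x₀ ∈ closedBall (0 : St n) r, ∀ π, IsPolicy D π →
      ∀ k, ‖traj f x₀ π k‖ ≤ lam ^ k * M * ‖x₀‖)
    {x₀ : St n} {K : ℕ}
    (hK : ∀ π, IsPolicy D π → ∃ k, k ≤ K ∧ traj f x₀ π k ∈ closedBall (0 : St n) ρ) :
    ∀ᶠ x in 𝓝 x₀, ∀ π, IsPolicy D π → ∀ i, ‖traj f x π (i + K)‖ ≤ lam ^ i * M * r := by
  have hclose : ∀ k, ∀ᶠ x in 𝓝 x₀, ∀ π, IsPolicy D π →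
      dist (traj f x π k) (traj f x₀ π k) < r - ρ := fun k => by
    obtain ⟨v, hv, hvd⟩ := (isCompact_setOf_isPolicy hD).mem_uniformity_of_prod
      (f := fun x π => traj f x π k) (continuous_traj hf k).continuousOn (mem_univ x₀)
      (Metric.dist_mem_uniformity (sub_pos.2 hρ))
    rw [nhdsWithin_univ] at hv
    filter_upwards [hv] with x hx π hπ using hvd x hx π hπ
  filter_upwards [(Filter.eventually_all_finset (Finset.range (K + 1))).2 fun k _ => hclose k]
    with x hx π hπ i
  obtain ⟨k, hkK, hk⟩ := hK π hπ
  have hxr : ‖traj f x π k‖ ≤ r := by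
    have h := hx k (Finset.mem_range.2 (by omega)) π hπ
    rw [dist_eq_norm] at h
    rw [mem_closedBall_zero_iff] at hk
    linarith [norm_le_norm_add_norm_sub (traj f x₀ π k) (traj f x π k),
      norm_sub_rev (traj f x₀ π k) (traj f x π k)]
  have hadd := traj_add f x π k (i + (K - k))
  rw [show k + (i + (K - k)) = i + K by omega] at hadd
  rw [hadd]
  refine (hstab _ (mem_closedBall_zero_iff.2 hxr) _ (fun j => hπ (k + j)) _).trans ?_
  have hpow : lam ^ (i + (K - k)) ≤ lam ^ i :=
    pow_le_pow_of_le_one hlam0.le hlam1.le (Nat.le_add_right _ _)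
  gcongr

theorem stmt14
    {n m nX : ℕ} (hnX : 0 < nX)
    (f : St n → St m → St n) (hfpoly : IsPolyMap2 f)
    (D : Set (St m)) (hD : IsCompact D)
    (hf0 : ∀ d ∈ D, f 0 d = 0)
    (hX : Fin nX → St n → ℝ) (hXpoly : ∀ j, IsPolyFun (hX j))
    (hX0 : ∀ j, hX j 0 = 0) (hXpos : ∀ j, ∀ x : St n, x ≠ 0 → 0 < hX j x)
    (X : Set (St n)) (hXdef : X = {x | ∀ j, hX j x < 1})
    (hXbdd : Bornology.IsBounded X) (hXopen : IsOpen X)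
    (M r lam : ℝ) (hM : 0 < M) (hr : 0 < r) (hlam0 : 0 < lam) (hlam1 : lam < 1)
    (hball : closedBall (0 : St n) r ⊆ X)
    (hstab : ∀ x₀ ∈ closedBall (0 : St n) r, ∀ π, IsPolicy D π →
      ∀ k, ‖traj f x₀ π k‖ ≤ lam ^ k * M * ‖x₀‖)
    (g : St n → ℝ) (hgpoly : IsPolyFun g) (hgnn : ∀ x, 0 ≤ g x)
    (hgzero : ∀ x : St n, g x = 0 ↔ x = 0)
    :
    (∀ x ∈ R0 f D X (min (r / (2 * M)) (r / 2)),
      (⨆ π ∈ {π : ℕ → St m | IsPolicy D π},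
        ∑' i : ℕ, ENNReal.ofReal (Real.log (g (traj f x π i) + 1))) ≠ ⊤) ∧
    ContinuousOn (fun x => (⨆ π ∈ {π : ℕ → St m | IsPolicy D π},
        ∑' i : ℕ, ENNReal.ofReal (Real.log (g (traj f x π i) + 1))).toReal)
      (R0 f D X (min (r / (2 * M)) (r / 2))) := by
  have hP := isCompact_setOf_isPolicy hD
  have hf := hfpoly.continuous
  have hgc : Continuous g := (hgpoly.contDiff (k := 1)).continuous
  have hpos : ∀ x, 0 < g x + 1 := fun x => by linarith [hgnn x]
  obtain ⟨C, hC⟩ := (hgpoly.contDiff (k := 1)).contDiffOn.exists_lipschitzOnWith one_ne_zero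
    (convex_closedBall (0 : St n) (M * r)) (isCompact_closedBall _ _)
  have hlog : ∀ x ∈ closedBall (0 : St n) (M * r), Real.log (g x + 1) ≤ C * ‖x‖ := fun x hx => by
    have h := hC.dist_le_mul x hx 0 (mem_closedBall_self (by positivity))
    rw [dist_zero_right, (hgzero 0).2 rfl, dist_zero_right, Real.norm_of_nonneg (hgnn x)] at h
    linarith [Real.log_le_sub_one_of_pos (hpos x)]
  have key : ∀ x₀ ∈ R0 f D X (min (r / (2 * M)) (r / 2)),
      (⨆ π ∈ {π : ℕ → St m | IsPolicy D π},
        ∑' i : ℕ, ENNReal.ofReal (Real.log (g (traj f x₀ π i) + 1))) ≠ ⊤ ∧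
      ContinuousAt (fun x => (⨆ π ∈ {π : ℕ → St m | IsPolicy D π},
        ∑' i : ℕ, ENNReal.ofReal (Real.log (g (traj f x π i) + 1))).toReal) x₀ := by
    rintro x₀ ⟨-, K, hK⟩
    have hev := exists_nhds_norm_traj_le hf hD hM hlam0 hlam1
      ((min_le_right (r / (2 * M)) (r / 2)).trans_lt (half_lt_self hr)) hstab
      fun π hπ => (hK π hπ).imp fun k hk => hk.2
    obtain ⟨δ, hδ, hball'⟩ := Metric.nhds_basis_closedBall.mem_iff.1 hev
    refine iSup_tsum_ne_top_and_continuousAt (F := fun i x π => Real.log (g (traj f x π i) + 1))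
      (b := fun i => lam ^ i * (C * (M * r))) K hP (isCompact_closedBall x₀ δ)
      (closedBall_mem_nhds x₀ hδ) (fun i => ?_) (fun i x π => ?_) ?_ fun i x hx π hπ => ?_
    · exact ((hgc.comp (continuous_traj hf i)).add continuous_const).log fun q => (hpos _).ne'
    · exact Real.log_nonneg (by linarith [hgnn (traj f x π i)])
    · exact (summable_geometric_of_lt_one hlam0.le hlam1).mul_right _
    · have h := hball' hx π hπ i
      have hle : ‖traj f x π (i + K)‖ ≤ M * r := h.trans (by
        rw [mul_assoc]
        exact mul_le_of_le_one_left (by positivity) (pow_le_one₀ hlam0.le hlam1.le))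
      calc Real.log (g (traj f x π (i + K)) + 1) ≤ C * ‖traj f x π (i + K)‖ :=
            hlog _ (mem_closedBall_zero_iff.2 hle)
        _ ≤ C * (lam ^ i * M * r) := by gcongr
        _ = lam ^ i * (C * (M * r)) := by ring
  exact ⟨fun x hx => (key x hx).1, fun x hx => (key x hx).2.continuousWithinAt⟩
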